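/- Let R be a left Noetherian ring. Then the finitistic dimension of R equals the supremum of qpd_R(M) taken over all finitely generated left R-modules M with qpd_R(M) < ∞. In particular, if qgldim(R) < ∞, then findim(R) = qgldim(R). -/

import Mathlib

/-!
Quasi-projective dimension, following Gheibi–Jorgensen–Takahashi and
Chen–Chen–Liu, "Properties of quasi-projective dimension over abelian categories".
-/

open CategoryTheory CategoryTheory.Limits

attribute [local instance] CategoryTheory.Abelian.hasFiniteBiproducts

noncomputable section

universe v u

namespace QPD

variable {A : Type*} [Category A] [Abelian A]

/-- The direct sum of `n` copies of `M`. -/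
def copies (M : A) (n : ℕ) : A := ⨁ (fun _ : Fin n => M)

/-- `X` belongs to `add M`: it is a direct summand of a finite direct sum of copies of `M`. -/
def inAdd (M X : A) : Prop :=
  ∃ (n : ℕ) (s : X ⟶ copies M n) (r : copies M n ⟶ X), s ≫ r = 𝟙 X

/-- `P` is a quasi-projective resolution of `M`: a bounded-below complex of projective
objects whose `j`-th homology is a direct sum of `mult j` copies of `M`, where the
multiplicities `mult j` are not all zero. -/
structure IsQuasiProjRes (M : A) (P : ChainComplex A ℤ) : Prop where
  projective : ∀ i, Projective (P.X i)
  bddBelow : ∃ a : ℤ, ∀ i, i < a → IsZero (P.X i)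
  homology_iso : ∃ mult : ℤ → ℕ, (∃ j, mult j ≠ 0) ∧
    ∀ j, Nonempty (P.homology j ≅ copies M (mult j))

/-- `P` is a finite (i.e. bounded) quasi-projective resolution of `M`. -/
structure IsFiniteQuasiProjRes (M : A) (P : ChainComplex A ℤ) extends
    IsQuasiProjRes M P : Prop where
  bddAbove : ∃ b : ℤ, ∀ i, b < i → IsZero (P.X i)

/-- `s` is the supremum of the degrees in which `P` is nonzero. -/
def IsSup (P : ChainComplex A ℤ) (s : ℤ) : Prop :=
  ¬ IsZero (P.X s) ∧ ∀ i, s < i → IsZero (P.X i)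

/-- `t` is the supremum of the degrees in which the homology of `P` is nonzero. -/
def IsHSup (P : ChainComplex A ℤ) (t : ℤ) : Prop :=
  ¬ IsZero (P.homology t) ∧ ∀ i, t < i → IsZero (P.homology i)

/-- `t` is the infimum of the degrees in which the homology of `P` is nonzero. -/
def IsHInf (P : ChainComplex A ℤ) (t : ℤ) : Prop :=
  ¬ IsZero (P.homology t) ∧ ∀ i, i < t → IsZero (P.homology i)

open Classical in
/-- The quasi-projective dimension of `M`, as an element of `ℕ∞`: the infimum of
`sup P• - hsup P•` over all finite quasi-projective resolutions `P•` of `M`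
(it is `0` for the zero object and `⊤` if no finite quasi-projective resolution exists). -/
def qpd (M : A) : ℕ∞ :=
  if IsZero M then 0
  else sInf {d : ℕ∞ | ∃ (P : ChainComplex A ℤ) (s t : ℤ),
    IsFiniteQuasiProjRes M P ∧ IsSup P s ∧ IsHSup P t ∧ d = ((s - t).toNat : ℕ∞)}

/-- `M` admits a projective resolution of length at most `n`. -/
def pdLE (M : A) (n : ℕ) : Prop :=
  ∃ P : ChainComplex A ℤ, (∀ i, Projective (P.X i)) ∧
    (∀ i : ℤ, i < 0 → IsZero (P.X i)) ∧ (∀ i : ℤ, (n : ℤ) < i → IsZero (P.X i)) ∧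
    (∀ i : ℤ, i ≠ 0 → IsZero (P.homology i)) ∧ Nonempty (P.homology 0 ≅ M)

/-- The projective dimension of `M`, as an element of `ℕ∞`. -/
def pd (M : A) : ℕ∞ := sInf {d : ℕ∞ | ∃ n : ℕ, d = (n : ℕ∞) ∧ pdLE M n}

open Classical in
/-- Quasi-projective dimension computed using only complexes all of whose terms satisfy the
predicate `Q` (e.g. `Q` = "finitely generated", for the category of finitely presented
modules over a left coherent ring). -/
def qpdRel (Q : A → Prop) (M : A) : ℕ∞ :=
  if IsZero M then 0
  else sInf {d : ℕ∞ | ∃ (P : ChainComplex A ℤ) (s t : ℤ),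
    IsFiniteQuasiProjRes M P ∧ (∀ i, Q (P.X i)) ∧ IsSup P s ∧ IsHSup P t ∧
    d = ((s - t).toNat : ℕ∞)}

/-- Projective dimension computed using only resolutions all of whose terms satisfy the
predicate `Q`. -/
def pdRel (Q : A → Prop) (M : A) : ℕ∞ :=
  sInf {d : ℕ∞ | ∃ n : ℕ, d = (n : ℕ∞) ∧ ∃ P : ChainComplex A ℤ,
    (∀ i, Projective (P.X i)) ∧ (∀ i, Q (P.X i)) ∧
    (∀ i : ℤ, i < 0 → IsZero (P.X i)) ∧ (∀ i : ℤ, (n : ℤ) < i → IsZero (P.X i)) ∧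
    (∀ i : ℤ, i ≠ 0 → IsZero (P.homology i)) ∧ Nonempty (P.homology 0 ≅ M)}

/-- Vanishing of the `n`-th Ext group, `Ext_𝒜^n(M, N) = 0`. -/
def extIsZero [EnoughProjectives A] (M N : A) (n : ℕ) : Prop :=
  IsZero (((_root_.Ext ℤ A n).obj (Opposite.op M)).obj N)

/-- The quasi-projective dimension of a finitely presented module over a (left coherent)
ring, computed inside the abelian category of finitely presented modules, i.e. via bounded
complexes of finitely generated projective modules. -/
def qpdFG {R : Type u} [Ring R] (M : ModuleCat.{u} R) : ℕ∞ :=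
  qpdRel (fun N : ModuleCat.{u} R => Module.Finite R N) M

/-- The projective dimension of a finitely presented module over a (left coherent) ring,
computed inside the abelian category of finitely presented modules. -/
def pdFG {R : Type u} [Ring R] (M : ModuleCat.{u} R) : ℕ∞ :=
  pdRel (fun N : ModuleCat.{u} R => Module.Finite R N) M

/-- A ring is left coherent if every finitely generated left ideal is finitely presented. -/
def IsLeftCoherent (R : Type u) [Ring R] : Prop :=
  ∀ I : Ideal R, I.FG → Module.FinitePresentation R I

/-- The quasi-global dimension of a ring: the supremum of the quasi-projective dimensions
of all finitely generated left modules. -/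
def qgldim (R : Type u) [Ring R] : ℕ∞ :=
  sSup {d : ℕ∞ | ∃ M : ModuleCat.{u} R, Module.Finite R M ∧ d = qpd M}

/-- The global dimension of a ring: the supremum of the projective dimensions of all
finitely generated left modules. -/
def gldim (R : Type u) [Ring R] : ℕ∞ :=
  sSup {d : ℕ∞ | ∃ M : ModuleCat.{u} R, Module.Finite R M ∧ d = pd M}

/-- The finitistic dimension of a ring: the supremum of the projective dimensions of all
finitely generated left modules of finite projective dimension. -/
def findim (R : Type u) [Ring R] : ℕ∞ :=
  sSup {d : ℕ∞ | ∃ M : ModuleCat.{u} R, Module.Finite R M ∧ d = pd M ∧ pd M ≠ ⊤}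

/-- The depth of a module over a Noetherian local ring:
`depth M = inf {i : Ext^i(R/𝔪, M) ≠ 0}`. -/
def depth {R : Type u} [CommRing R] [IsLocalRing R] (M : ModuleCat.{u} R) : ℕ∞ :=
  sInf {d : ℕ∞ | ∃ n : ℕ, d = (n : ℕ∞) ∧
    ¬ IsZero (((_root_.Ext ℤ (ModuleCat.{u} R) n).obj
      (Opposite.op (ModuleCat.of R (IsLocalRing.ResidueField R)))).obj M)}

end QPD

end

namespace QPD

section Abelian

variable {A : Type*} [Category A] [Abelian A]

/-- The embedding `n ↦ k - n`, whose associated truncation keeps the degrees `≤ k`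
of a chain complex. -/
def embeddingUpDown (k : ℤ) : (ComplexShape.up ℕ).Embedding (ComplexShape.down ℤ) :=
  ComplexShape.Embedding.mk' _ _ (fun n => k - n)
    (fun _ _ h => by dsimp at h; lia)
    (fun _ _ => by simp only [ComplexShape.up_Rel, ComplexShape.down_Rel]; lia)

instance (k : ℤ) : (embeddingUpDown k).IsRelIff where
  rel' n m h := by
    have h' : k - (m : ℤ) + 1 = k - n := h
    rw [ComplexShape.up_Rel]
    lia

instance (k : ℤ) : (embeddingUpDown k).IsTruncGE where
  mem_next {n i} h := ⟨n + 1, by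
    have h' : i + 1 = k - n := h
    change k - ((n + 1 : ℕ) : ℤ) = i
    lia⟩

/-- The canonical embedding of `ℕ`-indexed chain complexes into `ℤ`-indexed ones. -/
def embeddingDownDown : (ComplexShape.down ℕ).Embedding (ComplexShape.down ℤ) :=
  ComplexShape.Embedding.mk' _ _ (fun n => (n : ℤ))
    (fun _ _ h => by dsimp at h; lia)
    (fun _ _ => by simp only [ComplexShape.down_Rel]; lia)

lemma isZero_homology_of_isZero_X (P : ChainComplex A ℤ) {i : ℤ} (h : IsZero (P.X i)) :
    IsZero (P.homology i) :=
  HomologicalComplex.ExactAt.isZero_homology (ShortComplex.exact_of_isZero_X₂ _ h)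

/-- Truncation of a chain complex in degrees `≤ k`, with `P.opcycles k` in degree `k`. -/
lemma exists_truncation (P : ChainComplex A ℤ) (k : ℤ) :
    ∃ Q : ChainComplex A ℤ, (∀ i, i < k → Nonempty (P.X i ≅ Q.X i)) ∧
      Nonempty (P.opcycles k ≅ Q.X k) ∧ (∀ i, k < i → IsZero (Q.X i)) ∧
      ∀ i, i ≤ k → Nonempty (P.homology i ≅ Q.homology i) := by
  have hf (i : ℤ) (hi : i ≤ k) : (embeddingUpDown k).f (k - i).toNat = i := by
    change k - ((k - i).toNat : ℤ) = i
    lia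
  have h0 : (embeddingUpDown k).BoundaryGE 0 := by
    refine (embeddingUpDown k).boundaryGE (i' := k + 1) (j := 0) ?_ ?_
    · change k - ((0 : ℕ) : ℤ) + 1 = k + 1
      simp
    · intro n hn
      have : k - (n : ℤ) = k + 1 := hn
      lia
  refine ⟨P.truncGE (embeddingUpDown k), fun i hi => ⟨(P.truncGEXIso _ (hf i hi.le) ?_).symm⟩,
    ⟨(P.truncGEXIsoOpcycles _ (i := 0) ?_ h0).symm⟩, fun i hi => ?_, fun i hi => ?_⟩
  · obtain ⟨m, hm⟩ : ∃ m, (k - i).toNat = m + 1 := ⟨(k - i).toNat - 1, by lia⟩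
    rw [hm]
    exact (embeddingUpDown k).not_boundaryGE_next (j := m) rfl
  · change k - ((0 : ℕ) : ℤ) = k
    simp
  · refine (P.truncGE (embeddingUpDown k)).isZero_X_of_isStrictlySupported
      (embeddingUpDown k) i fun n hn => ?_
    have : k - (n : ℤ) = i := hn
    lia
  · have := P.quasiIsoAt_πTruncGE (embeddingUpDown k) (hf i hi)
    exact ⟨isoOfQuasiIsoAt (P.πTruncGE (embeddingUpDown k)) i⟩

/-- The image of the differential `P.X i ⟶ P.X j`, presented as the image of
`P.opcycles i ⟶ P.X j`. -/
noncomputable abbrev boundaries (P : ChainComplex A ℤ) (i j : ℤ) : A := image (P.fromOpcycles i j)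

lemma shortExact_homology_opcycles (P : ChainComplex A ℤ) {i j : ℤ} (hij : j + 1 = i) :
    ∃ w, (ShortComplex.mk (P.homologyι i) (factorThruImage (P.fromOpcycles i j)) w).ShortExact := by
  have w : P.homologyι i ≫ factorThruImage (P.fromOpcycles i j) = 0 := by
    simp [← cancel_mono (image.ι (P.fromOpcycles i j))]
  refine ⟨w, ?_⟩
  have hk := P.homologyIsKernel i j ((ComplexShape.down ℤ).next_eq' hij)
  exact
    { exact := ShortComplex.exact_of_f_is_kernel _
        (isKernelOfComp (image.ι (P.fromOpcycles i j)) _ hk w (image.fac _))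
      mono_f := by dsimp; infer_instance
      epi_g := by dsimp; infer_instance }

lemma shortExact_boundaries (P : ChainComplex A ℤ) {i j : ℤ} (hij : j + 1 = i) :
    ∃ w, (ShortComplex.mk (image.ι (P.fromOpcycles i j)) (P.pOpcycles j) w).ShortExact := by
  have w' : P.fromOpcycles i j ≫ P.pOpcycles j = 0 := by
    simp [← cancel_epi (P.pOpcycles i)]
  have w : image.ι (P.fromOpcycles i j) ≫ P.pOpcycles j = 0 := by
    simp [← cancel_epi (factorThruImage (P.fromOpcycles i j)), w']
  refine ⟨w, ?_⟩
  have hk := P.opcyclesIsCokernel i j ((ComplexShape.down ℤ).prev_eq' hij)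
  exact
    { exact := ShortComplex.exact_of_g_is_cokernel _
        (isCokernelOfComp (P.pOpcycles i ≫ factorThruImage (P.fromOpcycles i j)) _ hk w
          (by simp))
      mono_f := by dsimp; infer_instance
      epi_g := by dsimp; infer_instance }

lemma hasProjectiveDimensionLE_opcycles_iff (P : ChainComplex A ℤ)
    (hP : ∀ i, Projective (P.X i)) (k : ℤ) (n : ℕ)
    (h : ∀ i, k < i → i ≤ k + n → IsZero (P.homology i)) :
    HasProjectiveDimensionLE (P.opcycles k) n ↔ Projective (P.opcycles (k + n)) := by
  induction n generalizing k with
  | zero => simp [projective_iff_hasProjectiveDimensionLE_zero]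
  | succ n ih =>
    obtain ⟨_, h₁⟩ := shortExact_boundaries P (rfl : k + 1 = k + 1)
    obtain ⟨_, h₂⟩ := shortExact_homology_opcycles P (rfl : k + 1 = k + 1)
    have hz : IsZero (P.homology (k + 1)) := h _ (by lia) (by lia)
    have : IsIso (factorThruImage (P.fromOpcycles (k + 1) k)) := by
      have := (h₂.isIso_g_iff).2 hz
      exact this
    have e := asIso (factorThruImage (P.fromOpcycles (k + 1) k))
    have h₃ := ih (k + 1) (fun i hi hi' => h i (by lia) (by push_cast; lia))
    rw [show k + ((n + 1 : ℕ) : ℤ) = k + 1 + n by push_cast; ring, ← h₃]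
    refine (h₁.hasProjectiveDimensionLT_X₃_iff n (hP k)).trans ⟨fun h => ?_, fun h => ?_⟩
    · exact @hasProjectiveDimensionLT_of_iso _ _ _ _ _ e.symm _ h
    · exact @hasProjectiveDimensionLT_of_iso _ _ _ _ _ e _ h

lemma nonempty_opcycles_iso_homology (P : ChainComplex A ℤ) {i : ℤ}
    (h : IsZero (P.X (i - 1))) : Nonempty (P.homology i ≅ P.opcycles i) :=
  ⟨P.isoHomologyι i (i - 1) ((ComplexShape.down ℤ).next_eq' (by simp)) (h.eq_of_tgt _ _)⟩

lemma nonempty_iso_opcycles (P : ChainComplex A ℤ) {i : ℤ}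
    (h : IsZero (P.X (i + 1))) : Nonempty (P.X i ≅ P.opcycles i) :=
  ⟨P.pOpcyclesIso (i + 1) i ((ComplexShape.down ℤ).prev_eq' (by simp)) (h.eq_of_src _ _)⟩

lemma hasProjectiveDimensionLE_opcycles (P : ChainComplex A ℤ)
    (hP : ∀ i, Projective (P.X i)) (k : ℤ) (n : ℕ)
    (h : ∀ i, k < i → i ≤ k + n → IsZero (P.homology i)) (h' : IsZero (P.X (k + n + 1))) :
    HasProjectiveDimensionLE (P.opcycles k) n := by
  rw [hasProjectiveDimensionLE_opcycles_iff P hP k n h]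
  obtain ⟨e⟩ := nonempty_iso_opcycles P h'
  exact Projective.of_iso e (hP _)

lemma exists_projective_resolution [EnoughProjectives A] (M : A) :
    ∃ P : ChainComplex A ℤ, (∀ i, Projective (P.X i)) ∧ (∀ i : ℤ, i < 0 → IsZero (P.X i)) ∧
      (∀ i : ℤ, i ≠ 0 → IsZero (P.homology i)) ∧ Nonempty (P.homology 0 ≅ M) := by
  let Q := ProjectiveResolution.of M
  have hf (n : ℕ) : embeddingDownDown.f n = (n : ℤ) := rfl
  have hneg (i : ℤ) (hi : i < 0) : IsZero ((Q.complex.extend embeddingDownDown).X i) :=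
    Q.complex.isZero_extend_X _ i fun n hn => by rw [hf] at hn; lia
  refine ⟨Q.complex.extend embeddingDownDown, fun i => ?_, hneg, fun i hi => ?_, ?_⟩
  · rcases lt_or_ge i 0 with hi | hi
    · exact (hneg i hi).projective
    · obtain ⟨n, rfl⟩ := Int.eq_ofNat_of_zero_le hi
      exact Projective.of_iso (Q.complex.extendXIso embeddingDownDown (hf n)).symm inferInstance
  · rcases lt_or_ge i 0 with hi' | hi'
    · exact isZero_homology_of_isZero_X _ (hneg i hi')
    · obtain ⟨n, rfl⟩ := Int.eq_ofNat_of_zero_le hi'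
      obtain ⟨m, rfl⟩ : ∃ m, n = m + 1 := ⟨n - 1, by lia⟩
      exact (Q.complex_exactAt_succ m).isZero_homology.of_iso
        (Q.complex.extendHomologyIso embeddingDownDown (hf (m + 1)))
  · exact ⟨Q.complex.extendHomologyIso embeddingDownDown (hf 0) ≪≫
      isoOfQuasiIsoAt Q.π 0 ≪≫ HomologicalComplex.singleObjHomologySelfIso _ _ _⟩

lemma hasProjectiveDimensionLE_of_pdLE {M : A} {n : ℕ} (h : pdLE M n) :
    HasProjectiveDimensionLE M n := by
  obtain ⟨P, hP, hneg, hpos, hH, ⟨e⟩⟩ := h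
  obtain ⟨e'⟩ := nonempty_opcycles_iso_homology P (hneg (0 - 1) (by lia))
  have := hasProjectiveDimensionLE_opcycles P hP 0 n (fun i hi _ => hH i hi.ne')
    (hpos _ (by lia))
  exact hasProjectiveDimensionLT_of_iso (e'.symm ≪≫ e) _

lemma pdLE_iff [EnoughProjectives A] (M : A) (n : ℕ) :
    pdLE M n ↔ HasProjectiveDimensionLE M n := by
  refine ⟨hasProjectiveDimensionLE_of_pdLE, fun h => ?_⟩
  obtain ⟨P, hP, hneg, hH, ⟨e⟩⟩ := exists_projective_resolution M
  obtain ⟨e'⟩ := nonempty_opcycles_iso_homology P (hneg (0 - 1) (by lia))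
  have hn : Projective (P.opcycles (n : ℤ)) := by
    have := (hasProjectiveDimensionLE_opcycles_iff P hP 0 n (fun i hi _ => hH i hi.ne')).1
      (hasProjectiveDimensionLT_of_iso (e.symm ≪≫ e') _)
    rwa [zero_add] at this
  obtain ⟨Q, hQ, ⟨eQ⟩, hQ', hQH⟩ := exists_truncation P n
  refine ⟨Q, fun i => ?_, fun i hi => ?_, hQ', fun i hi => ?_, ?_⟩
  · rcases lt_trichotomy i n with hi | rfl | hi
    · exact Projective.of_iso (hQ i hi).some (hP i)
    · exact Projective.of_iso eQ hn
    · exact (hQ' i hi).projective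
  · exact (hneg i hi).of_iso (hQ i (by lia)).some.symm
  · rcases le_or_gt i n with hi' | hi'
    · exact (hH i hi).of_iso (hQH i hi').some.symm
    · exact isZero_homology_of_isZero_X _ (hQ' i hi')
  · exact ⟨(hQH 0 (by lia)).some.symm ≪≫ e⟩

@[elab_as_elim]
lemma int_induction_of_lt {p : ℤ → Prop} (a : ℤ) (lt : ∀ k, k < a → p k)
    (succ : ∀ k, p k → p (k + 1)) (k : ℤ) : p k := by
  have h (n : ℕ) : p (a - 1 + n) := by
    induction n with
    | zero => exact lt _ (by lia)
    | succ n ih => simpa [add_assoc] using succ _ ih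
  rcases lt_or_ge k a with hk | hk
  · exact lt k hk
  · have hk' := h (k - (a - 1)).toNat
    rwa [show a - 1 + ((k - (a - 1)).toNat : ℤ) = k by lia] at hk'

lemma hasProjectiveDimensionLT_copies (M : A) (n k : ℕ) [HasProjectiveDimensionLT M k] :
    HasProjectiveDimensionLT (copies M n) k := by
  let := HasExt.standard A
  change HasProjectiveDimensionLT (⨁ fun _ : Fin n => M) k
  rw [hasProjectiveDimensionLT_iff]
  intro i hi Y e
  rw [← e.mk₀_id_comp, ← biproduct.total, Abelian.Ext.mk₀_sum, Abelian.Ext.sum_comp]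
  refine Finset.sum_eq_zero fun j _ => ?_
  rw [← Abelian.Ext.mk₀_comp_mk₀, Abelian.Ext.comp_assoc_of_second_deg_zero,
    ((Abelian.Ext.mk₀ _).comp e (zero_add i)).eq_zero_of_hasProjectiveDimensionLT k hi,
    Abelian.Ext.comp_zero]

/-- An object is a direct summand of a nonempty direct sum of copies of itself. -/
noncomputable def retractCopies (M : A) {n : ℕ} (hn : n ≠ 0) : Retract M (copies M n) where
  i := biproduct.ι (fun _ : Fin n => M) ⟨0, Nat.pos_of_ne_zero hn⟩
  r := biproduct.π (fun _ : Fin n => M) ⟨0, Nat.pos_of_ne_zero hn⟩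
  retract := biproduct.ι_π_self _ _

lemma isZero_copies_zero (M : A) : IsZero (copies M 0) := by
  rw [IsZero.iff_id_eq_zero]
  exact biproduct.hom_ext _ _ fun j => j.elim0

/-- If `M` has finite projective dimension, then the latter is bounded by the length of the
part of any finite quasi-projective resolution above its top homology. -/
lemma hasProjectiveDimensionLE_of_isQuasiProjRes {M : A} {P : ChainComplex A ℤ}
    (hP : IsQuasiProjRes M P) {t : ℤ} (ht : IsHSup P t) {d : ℕ}
    (hd : ∀ i, t + d < i → IsZero (P.X i)) {n : ℕ} (hn : HasProjectiveDimensionLE M n) :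
    HasProjectiveDimensionLE M d := by
  induction n with
  | zero => exact hasProjectiveDimensionLT_of_ge _ 1 _ (by lia)
  | succ m ih =>
    rcases lt_or_ge m d with hmd | hmd
    · exact hasProjectiveDimensionLT_of_ge _ (m + 1 + 1) _ (by lia)
    refine ih ?_
    obtain ⟨a, ha⟩ := hP.bddBelow
    obtain ⟨mult, -, hmult⟩ := hP.homology_iso
    have hB (k : ℤ) (hk : HasProjectiveDimensionLE (P.opcycles k) (m + 1)) :
        HasProjectiveDimensionLE (boundaries P (k + 1) k) m := by
      obtain ⟨_, h⟩ := shortExact_boundaries P (rfl : k + 1 = k + 1)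
      have := hP.projective k
      exact h.hasProjectiveDimensionLT_X₁ _ (hasProjectiveDimensionLT_of_ge _ 1 _ (by lia)) hk
    have hC (k : ℤ) : HasProjectiveDimensionLE (P.opcycles k) (m + 1) := by
      induction k using int_induction_of_lt a with
      | lt k hk =>
        have := (IsZero.of_epi (P.pOpcycles k) (ha k hk)).hasProjectiveDimensionLT_zero
        exact hasProjectiveDimensionLT_of_ge _ 0 _ (by lia)
      | succ k ih =>
        obtain ⟨_, h⟩ := shortExact_homology_opcycles P (rfl : k + 1 = k + 1)
        have := hasProjectiveDimensionLT_copies M (mult (k + 1)) (m + 1 + 1)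
        have := hB k ih
        exact h.hasProjectiveDimensionLT_X₂ _
          (hasProjectiveDimensionLT_of_iso (hmult (k + 1)).some.symm _)
          (hasProjectiveDimensionLT_of_ge _ (m + 1) _ (by lia))
    obtain ⟨_, h⟩ := shortExact_homology_opcycles P (show t - 1 + 1 = t by lia)
    have hB' := hB (t - 1) (hC _)
    rw [show t - 1 + 1 = t by lia] at hB'
    have hCt : HasProjectiveDimensionLE (P.opcycles t) d :=
      hasProjectiveDimensionLE_opcycles P hP.projective t d (fun i hi _ => ht.2 i hi)
        (hd _ (by lia))
    have hH : HasProjectiveDimensionLE (P.homology t) m :=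
      h.hasProjectiveDimensionLT_X₁ _ (hasProjectiveDimensionLT_of_ge _ (d + 1) _ (by lia))
        (hasProjectiveDimensionLT_of_ge _ (m + 1) _ (by lia))
    have hmt : mult t ≠ 0 := fun h0 => ht.1 <| by
      have e := (hmult t).some
      rw [h0] at e
      exact (isZero_copies_zero M).of_iso e
    have := hasProjectiveDimensionLT_of_iso (hmult t).some (m + 1)
    exact (retractCopies M hmt).hasProjectiveDimensionLT _

end Abelian

section StablyFG

variable {R : Type u} [Ring R]

/-- `M` becomes finitely generated up to projectives: for some projective `P`, the module
`M × P` has a projective quotient with finitely generated kernel. -/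
def StablyFG (M : Type u) [AddCommGroup M] [Module R M] : Prop :=
  ∃ (P G : ModuleCat.{u} R) (f : (M × P) →ₗ[R] G), Module.Projective R P ∧
    Module.Projective R G ∧ Function.Surjective f ∧ (LinearMap.ker f).FG

variable {X Y Z : Type u} [AddCommGroup X] [AddCommGroup Y] [AddCommGroup Z]
  [Module R X] [Module R Y] [Module R Z]

lemma StablyFG.of_surjective (hY : StablyFG (R := R) Y) (g : X →ₗ[R] Y)
    (hg : Function.Surjective g) (hk : (LinearMap.ker g).FG) : StablyFG (R := R) X := by
  obtain ⟨P, G, f, hP, hG, hf, hfk⟩ := hY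
  have hs : Function.Surjective (g.prodMap (LinearMap.id : P →ₗ[R] P)) :=
    hg.prodMap Function.surjective_id
  refine ⟨P, G, f ∘ₗ g.prodMap LinearMap.id, hP, hG, hf.comp hs, ?_⟩
  refine Submodule.fg_ker_comp _ _ ?_ hfk hs
  rw [LinearMap.ker_prodMap, LinearMap.ker_id]
  exact hk.prod Submodule.fg_bot

lemma projective_ker_of_surjective {M G : Type*} [AddCommGroup M] [AddCommGroup G]
    [Module R M] [Module R G] [Module.Projective R M] [Module.Projective R G]
    (h : M →ₗ[R] G) (hh : Function.Surjective h) : Module.Projective R (LinearMap.ker h) := by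
  obtain ⟨s, hs⟩ := Module.projective_lifting_property h LinearMap.id hh
  have hs' (x : G) : h (s x) = x := LinearMap.congr_fun hs x
  refine Module.Projective.of_split (LinearMap.ker h).subtype
    ((LinearMap.id - s ∘ₗ h).codRestrict (LinearMap.ker h) fun x => by simp [hs']) ?_
  ext x
  have : h (x : M) = 0 := x.2
  simp [this]

lemma StablyFG.of_exact [IsNoetherianRing R] (hZ : StablyFG (R := R) Z)
    [Module.Projective R Y] (i : X →ₗ[R] Y) (q : Y →ₗ[R] Z) (hi : Function.Injective i)
    (hq : Function.Surjective q) (hiq : Function.Exact i q) : StablyFG (R := R) X := by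
  obtain ⟨P, G, f, hP, hG, hf, hfk⟩ := hZ
  have hs : Function.Surjective (q.prodMap (LinearMap.id : P →ₗ[R] P)) :=
    hq.prodMap Function.surjective_id
  let h : (Y × P) →ₗ[R] G := f ∘ₗ q.prodMap LinearMap.id
  have hproj := projective_ker_of_surjective h (hf.comp hs)
  let ρ : LinearMap.ker h →ₗ[R] LinearMap.ker f :=
    ((q.prodMap LinearMap.id) ∘ₗ (LinearMap.ker h).subtype).codRestrict _ fun x => x.2
  have hρ : Function.Surjective ρ := by
    rintro ⟨y, hy⟩
    obtain ⟨x, rfl⟩ := hs y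
    exact ⟨⟨x, hy⟩, rfl⟩
  have : Module.Finite R (LinearMap.ker f) := Module.Finite.of_fg hfk
  obtain ⟨n, p, hp⟩ := Module.Finite.exists_fin' R (LinearMap.ker f)
  obtain ⟨φ, hφ⟩ := Module.projective_lifting_property ρ p hρ
  let j : X →ₗ[R] LinearMap.ker h :=
    (LinearMap.inl R Y P ∘ₗ i).codRestrict _ fun x => by
      simp [h, hiq.apply_apply_eq_zero x, ← Prod.zero_eq_mk]
  have hj : Function.Injective j := fun x y hxy => hi (congrArg (fun z => z.1.1) hxy)
  let F : (X × (Fin n → R)) →ₗ[R] LinearMap.ker h := j.coprod φ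
  refine ⟨ModuleCat.of R (Fin n → R), ModuleCat.of R (LinearMap.ker h), F,
    inferInstanceAs (Module.Projective R (Fin n → R)), hproj, fun z => ?_, ?_⟩
  · obtain ⟨x, hx⟩ := hp (ρ z)
    have hz : ρ (z - φ x) = 0 := by
      rw [map_sub, ← LinearMap.comp_apply, hφ, hx, sub_self]
    have hz' : q.prodMap LinearMap.id (z - φ x).1 = 0 := congrArg Subtype.val hz
    obtain ⟨b, hb⟩ := (hiq (z - φ x).1.1).1 (congrArg Prod.fst hz')
    refine ⟨(b, x), ?_⟩
    have : j b = z - φ x := Subtype.ext (Prod.ext hb (congrArg Prod.snd hz').symm)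
    change j b + φ x = z
    rw [this, sub_add_cancel]
  · let r : LinearMap.ker F →ₗ[R] (Fin n → R) := LinearMap.snd R X _ ∘ₗ (LinearMap.ker F).subtype
    have hr : Function.Injective r := by
      rw [← LinearMap.ker_eq_bot, LinearMap.ker_eq_bot']
      rintro ⟨⟨b, x⟩, hbx⟩ (rfl : x = 0)
      have hb : j b + φ 0 = 0 := hbx
      rw [map_zero, add_zero] at hb
      have : b = 0 := hj (hb.trans (map_zero j).symm)
      subst this
      rfl
    have := Module.Finite.of_injective r hr
    exact Module.Finite.iff_fg.1 this

lemma StablyFG.of_finite [Module.Finite R X] : StablyFG (R := R) X := by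
  refine ⟨ModuleCat.of R PUnit.{u + 1}, ModuleCat.of R PUnit.{u + 1}, 0,
    inferInstanceAs (Module.Projective R PUnit.{u + 1}),
    inferInstanceAs (Module.Projective R PUnit.{u + 1}), fun x => ⟨0, rfl⟩, ?_⟩
  rw [LinearMap.ker_zero]
  exact (inferInstance : Module.Finite R (X × PUnit.{u + 1})).fg_top

lemma stablyFG_opcycles [IsNoetherianRing R] (P : ChainComplex (ModuleCat.{u} R) ℤ)
    (hP : ∀ i, Projective (P.X i)) {a : ℤ} (ha : ∀ i, i < a → IsZero (P.X i))
    (hH : ∀ i, Module.Finite R (P.homology i)) (k : ℤ) : StablyFG (R := R) (P.opcycles k) := by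
  induction k using int_induction_of_lt a with
  | lt k hk =>
    have hz : IsZero (P.opcycles k) := IsZero.of_epi (P.pOpcycles k) (ha k hk)
    have := ModuleCat.subsingleton_of_isZero hz
    exact .of_finite
  | succ k ih =>
    obtain ⟨_, h₁⟩ := shortExact_boundaries P (rfl : k + 1 = k + 1)
    obtain ⟨_, h₂⟩ := shortExact_homology_opcycles P (rfl : k + 1 = k + 1)
    have : Module.Projective R (P.X k) := (IsProjective.iff_projective _).2 (hP k)
    have hB : StablyFG (R := R) (boundaries P (k + 1) k : ModuleCat.{u} R) :=
      ih.of_exact (image.ι (P.fromOpcycles (k + 1) k)).hom (P.pOpcycles k).hom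
        h₁.moduleCat_injective_f h₁.moduleCat_surjective_g
        ((ShortComplex.ShortExact.moduleCat_exact_iff_function_exact _).1 h₁.exact)
    refine hB.of_surjective (factorThruImage (P.fromOpcycles (k + 1) k)).hom
      h₂.moduleCat_surjective_g ?_
    have := hH (k + 1)
    rw [← h₂.exact.moduleCat_range_eq_ker]
    exact Module.Finite.iff_fg.1 (Module.Finite.range _)

lemma StablyFG.exists_finite {M : ModuleCat.{u} R} (hM : StablyFG (R := R) M) :
    ∃ F : ModuleCat.{u} R, Module.Finite R F ∧
      ∀ n, HasProjectiveDimensionLE F n ↔ HasProjectiveDimensionLE M n := by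
  obtain ⟨P, G, f, hP, hG, hf, hfk⟩ := hM
  have hP' : Projective P := (IsProjective.iff_projective P).1 hP
  have hG' : Projective G := (IsProjective.iff_projective G).1 hG
  refine ⟨ModuleCat.of R (LinearMap.ker f), Module.Finite.of_fg hfk, fun n => ?_⟩
  have h₁ := LinearMap.shortExact_shortComplexKer hf
  have h₂ : (ShortComplex.mk (ModuleCat.ofHom (LinearMap.inl R M P))
      (ModuleCat.ofHom (LinearMap.snd R M P)) (by ext; simp)).ShortExact :=
    ModuleCat.shortComplex_shortExact _ Function.Exact.inl_snd LinearMap.inl_injective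
      LinearMap.snd_surjective
  have hG₁ (k : ℕ) : HasProjectiveDimensionLT (ModuleCat.of R G) (k + 1) :=
    hasProjectiveDimensionLT_of_ge _ 1 _ (by lia)
  have hP₁ (k : ℕ) : HasProjectiveDimensionLT (ModuleCat.of R P) (k + 1) :=
    hasProjectiveDimensionLT_of_ge _ 1 _ (by lia)
  constructor
  · intro h
    exact h₂.hasProjectiveDimensionLT_X₁ _
      (h₁.hasProjectiveDimensionLT_X₂ _ h (hG₁ _)) (hP₁ _)
  · intro h
    exact h₁.hasProjectiveDimensionLT_X₁ _
      (h₂.hasProjectiveDimensionLT_X₂ _ h (hP₁ _)) (hG₁ _)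

end StablyFG

section Dimension

variable {A : Type*} [Category A] [Abelian A]

lemma pd_le_iff [EnoughProjectives A] (M : A) (n : ℕ) :
    pd M ≤ n ↔ HasProjectiveDimensionLE M n := by
  constructor
  · intro h
    have hne : {d : ℕ∞ | ∃ n : ℕ, d = (n : ℕ∞) ∧ pdLE M n}.Nonempty := by
      by_contra hne
      rw [pd, Set.not_nonempty_iff_eq_empty.1 hne, sInf_empty] at h
      exact ENat.natCast_ne_top n (top_le_iff.1 h)
    obtain ⟨m, hm, hm'⟩ := csInf_mem hne
    have hmn : m ≤ n := by
      rw [pd, hm] at h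
      exact_mod_cast h
    have := (pdLE_iff M m).1 hm'
    exact hasProjectiveDimensionLT_of_ge _ (m + 1) _ (by lia)
  · exact fun h => sInf_le ⟨n, rfl, (pdLE_iff M n).2 h⟩

lemma exists_isSup {P : ChainComplex A ℤ} {b : ℤ} (hb : ∀ i, b < i → IsZero (P.X i)) {t : ℤ}
    (ht : ¬ IsZero (P.X t)) : ∃ s, t ≤ s ∧ s ≤ b ∧ IsSup P s := by
  have hb' (i : ℤ) (hi : ¬ IsZero (P.X i)) : i ≤ b := not_lt.1 fun h => hi (hb i h)
  obtain ⟨s, hs, hs'⟩ := Int.exists_greatest_of_bdd ⟨b, hb'⟩ ⟨t, ht⟩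
  exact ⟨s, hs' t ht, hb' s hs, hs, fun i hi => by_contra fun h => (hs' i h).not_gt hi⟩

lemma qpd_of_isZero {M : A} (hM : IsZero M) : qpd M = 0 := if_pos hM

/-- A finite quasi-projective resolution bounds the quasi-projective dimension by the length of
its part above the top homology. -/
lemma qpd_le {M : A} {P : ChainComplex A ℤ} (hP : IsFiniteQuasiProjRes M P) {t : ℤ}
    (ht : IsHSup P t) {n : ℕ} (hn : ∀ i, t + n < i → IsZero (P.X i)) : qpd M ≤ n := by
  by_cases hM : IsZero M
  · simp [qpd_of_isZero hM]
  obtain ⟨s, hts, hsn, hs⟩ := exists_isSup hn fun h => ht.1 (isZero_homology_of_isZero_X P h)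
  rw [qpd, if_neg hM]
  have hst : (s - t).toNat ≤ n := by lia
  exact sInf_le_of_le ⟨P, s, t, hP, hs, ht, rfl⟩ (by exact_mod_cast hst)

lemma exists_of_qpd_ne_top {M : A} (hM : ¬ IsZero M) (h : qpd M ≠ ⊤) :
    ∃ (P : ChainComplex A ℤ) (s t : ℤ), IsFiniteQuasiProjRes M P ∧ IsSup P s ∧ IsHSup P t ∧
      qpd M = ((s - t).toNat : ℕ∞) := by
  rw [qpd, if_neg hM] at h ⊢
  have hne : {d : ℕ∞ | ∃ (P : ChainComplex A ℤ) (s t : ℤ), IsFiniteQuasiProjRes M P ∧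
      IsSup P s ∧ IsHSup P t ∧ d = ((s - t).toNat : ℕ∞)}.Nonempty := by
    refine Set.nonempty_iff_ne_empty.2 fun h' => h ?_
    rw [h', sInf_empty]
  exact csInf_mem hne

lemma IsSup.le_of_isHSup {P : ChainComplex A ℤ} {s t : ℤ} (hs : IsSup P s) (ht : IsHSup P t) :
    t ≤ s :=
  not_lt.1 fun h => ht.1 (isZero_homology_of_isZero_X P (hs.2 t h))

lemma pd_le_qpd [EnoughProjectives A] {M : A} (h : pd M ≠ ⊤) : pd M ≤ qpd M := by
  by_cases hM : IsZero M
  · have := hM.hasProjectiveDimensionLT_zero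
    rw [qpd_of_isZero hM]
    exact_mod_cast (pd_le_iff M 0).2 (hasProjectiveDimensionLT_of_ge _ 0 _ (by lia))
  by_cases hq : qpd M = ⊤
  · simp [hq]
  obtain ⟨P, s, t, hP, hs, ht, hst⟩ := exists_of_qpd_ne_top hM hq
  obtain ⟨n, hn⟩ := ENat.ne_top_iff_exists.1 h
  rw [hst, pd_le_iff]
  have := hs.le_of_isHSup ht
  exact hasProjectiveDimensionLE_of_isQuasiProjRes hP.toIsQuasiProjRes ht
    (fun i hi => hs.2 i (by lia)) ((pd_le_iff M n).1 hn.ge)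

/-- An object is isomorphic to the direct sum of one copy of itself. -/
noncomputable def isoCopiesOne (M : A) : M ≅ copies M 1 :=
  (biproductUniqueIso fun _ : Fin 1 => M).symm

lemma qpd_ne_top_of_pd_ne_top [EnoughProjectives A] {M : A} (h : pd M ≠ ⊤) : qpd M ≠ ⊤ := by
  by_cases hM : IsZero M
  · simp [qpd_of_isZero hM]
  obtain ⟨n, hn⟩ := ENat.ne_top_iff_exists.1 h
  obtain ⟨P, hP, hneg, hpos, hH, ⟨e⟩⟩ := (pdLE_iff M n).2 ((pd_le_iff M n).1 hn.ge)
  have hres : IsFiniteQuasiProjRes M P :=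
    { projective := hP
      bddBelow := ⟨0, hneg⟩
      bddAbove := ⟨n, hpos⟩
      homology_iso := by
        refine ⟨fun i => if i = 0 then 1 else 0, ⟨0, by simp⟩, fun j => ?_⟩
        by_cases hj : j = 0
        · subst hj
          exact ⟨e ≪≫ isoCopiesOne M⟩
        · simp only [hj, if_false]
          exact ⟨(hH j hj).iso (isZero_copies_zero M)⟩ }
  have hsup : IsHSup P 0 := ⟨fun h => hM (h.of_iso e.symm), fun i hi => hH i hi.ne'⟩
  exact ne_top_of_le_ne_top (ENat.natCast_ne_top n)
    (qpd_le hres hsup fun i hi => hpos i (by lia))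

/-- If the cokernel in some degree `k` at or above the top homology of a quasi-projective
resolution is projective, then truncating there gives a finite quasi-projective resolution. -/
lemma qpd_le_of_projective_opcycles {M : A} {P : ChainComplex A ℤ} (hP : IsQuasiProjRes M P)
    {t : ℤ} (ht : IsHSup P t) {n : ℕ} (h : Projective (P.opcycles (t + n))) : qpd M ≤ n := by
  obtain ⟨Q, hlt, ⟨e⟩, hgt, hH⟩ := exists_truncation P (t + n)
  obtain ⟨a, ha⟩ := hP.bddBelow
  have hta : a ≤ t := not_lt.1 fun hta => ht.1 (isZero_homology_of_isZero_X P (ha t hta))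
  have hHQ (j : ℤ) : Nonempty (P.homology j ≅ Q.homology j) := by
    rcases le_or_gt j (t + n) with hj | hj
    · exact hH j hj
    · exact ⟨(ht.2 j (by lia)).iso (isZero_homology_of_isZero_X Q (hgt j hj))⟩
  obtain ⟨mult, hne, hmult⟩ := hP.homology_iso
  have hQ : IsFiniteQuasiProjRes M Q :=
    { projective := fun i => by
        rcases lt_trichotomy i (t + n) with hi | rfl | hi
        · exact Projective.of_iso (hlt i hi).some (hP.projective i)
        · exact Projective.of_iso e h
        · exact (hgt i hi).projective
      bddBelow := ⟨a, fun i hi => (ha i hi).of_iso (hlt i (by lia)).some.symm⟩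
      bddAbove := ⟨_, hgt⟩
      homology_iso := ⟨mult, hne, fun j => ⟨(hHQ j).some.symm ≪≫ (hmult j).some⟩⟩ }
  exact qpd_le hQ ⟨fun h => ht.1 (h.of_iso (hHQ t).some),
    fun i hi => (ht.2 i hi).of_iso (hHQ i).some.symm⟩ hgt

end Dimension

section Finitistic

variable {R : Type u} [Ring R]

lemma finite_copies (M : ModuleCat.{u} R) [Module.Finite R M] (n : ℕ) :
    Module.Finite R (copies M n : ModuleCat.{u} R) :=
  Module.Finite.equiv (ModuleCat.biproductIsoPi fun _ : Fin n => M).toLinearEquiv.symm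

/-- Finite quasi-projective dimension of a finitely generated module over a left Noetherian ring
is bounded by the projective dimension of some finitely generated module. -/
lemma exists_qpd_le_pd [IsNoetherianRing R] (M : ModuleCat.{u} R) [Module.Finite R M]
    (h : qpd M ≠ ⊤) :
    ∃ F : ModuleCat.{u} R, Module.Finite R F ∧ pd F ≠ ⊤ ∧ qpd M ≤ pd F := by
  by_cases hM : IsZero M
  · have := hM.hasProjectiveDimensionLT_zero
    refine ⟨M, inferInstance, ne_top_of_le_ne_top (ENat.natCast_ne_top 0) ((pd_le_iff M 0).2
      (hasProjectiveDimensionLT_of_ge _ 0 _ (by lia))), by simp [qpd_of_isZero hM]⟩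
  obtain ⟨P, s, t, hP, hs, ht, hst⟩ := exists_of_qpd_ne_top hM h
  have hts := hs.le_of_isHSup ht
  obtain ⟨a, ha⟩ := hP.bddBelow
  obtain ⟨mult, -, hmult⟩ := hP.homology_iso
  have hfin (i : ℤ) : Module.Finite R (P.homology i) :=
    have := finite_copies M (mult i)
    Module.Finite.equiv (hmult i).some.symm.toLinearEquiv
  obtain ⟨F, hF, hFC⟩ := (stablyFG_opcycles P hP.projective ha hfin t).exists_finite
  have hle : pd F ≤ ((s - t).toNat : ℕ∞) := by
    rw [pd_le_iff, hFC]
    exact hasProjectiveDimensionLE_opcycles P hP.projective t _ (fun i hi _ => ht.2 i hi)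
      (hs.2 _ (by lia))
  refine ⟨F, hF, ne_top_of_le_ne_top (ENat.natCast_ne_top _) hle, ?_⟩
  obtain ⟨n, hn⟩ := ENat.ne_top_iff_exists.1 (ne_top_of_le_ne_top (ENat.natCast_ne_top _) hle)
  rw [← hn]
  have hFn := (hFC n).1 ((pd_le_iff F n).1 hn.ge)
  exact qpd_le_of_projective_opcycles hP.toIsQuasiProjRes ht
    ((hasProjectiveDimensionLE_opcycles_iff P hP.projective t n fun i hi _ => ht.2 i hi).1 hFn)

end Finitistic

end QPD

open QPD in
/-- For a left Noetherian ring, the finitistic dimension equals the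
supremum of the finite quasi-projective dimensions of finitely generated modules; in
particular if the quasi-global dimension is finite then it equals the finitistic
dimension. -/
theorem findim_eq_sup_finite_qpd {R : Type u} [Ring R] [IsNoetherianRing R] :
    findim R = sSup {d : ℕ∞ | ∃ M : ModuleCat.{u} R,
      Module.Finite R M ∧ d = qpd M ∧ qpd M ≠ ⊤} ∧
    (qgldim R ≠ ⊤ → findim R = qgldim R) := by
  have key : findim R = sSup {d : ℕ∞ | ∃ M : ModuleCat.{u} R,
      Module.Finite R M ∧ d = qpd M ∧ qpd M ≠ ⊤} := by
    apply le_antisymm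
    · refine sSup_le ?_
      rintro _ ⟨M, hM, rfl, hpd⟩
      exact (pd_le_qpd hpd).trans (le_sSup ⟨M, hM, rfl, qpd_ne_top_of_pd_ne_top hpd⟩)
    · refine sSup_le ?_
      rintro _ ⟨M, hM, rfl, hqpd⟩
      obtain ⟨F, hF, hpd, hle⟩ := exists_qpd_le_pd M hqpd
      exact hle.trans (le_sSup ⟨F, hF, rfl, hpd⟩)
  refine ⟨key, fun h => key.trans (congrArg sSup (Set.ext fun d => ?_))⟩
  constructor
  · rintro ⟨M, hM, hd, -⟩
    exact ⟨M, hM, hd⟩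
  · rintro ⟨M, hM, hd⟩
    exact ⟨M, hM, hd, ne_top_of_le_ne_top h (le_sSup ⟨M, hM, rfl⟩)⟩
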